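/- There exists a unique family of functions H_r : ℍ → ℂ indexed by r ∈ ℤ/4ℤ such that for all τ ∈ ℍ and all z ∈ ℂ with z ∉ ℤτ + ℤ, −2 Ψ_{1,1}(τ,z) φ^{(2)}_1(τ,z) = −24 μ_{2,0}(τ,z) + ∑_{r mod 4} H_r(τ) θ_{2,r}(τ,z). -/

import Mathlib

noncomputable section

open Complex

/-- `q = e^{2πiτ}` (also used for `u = e^{2πiz}`). -/
def qq (τ : ℂ) : ℂ := exp (2 * ↑Real.pi * I * τ)

/-- The Dedekind eta function `η(τ) = q^{1/24} ∏_{n≥1} (1 − qⁿ)`. -/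
def dedekindEta (τ : ℂ) : ℂ := exp (2 * ↑Real.pi * I * τ / 24) * ∏' n : ℕ, (1 - qq τ ^ (n + 1))

/-- `θ₁(τ,z) = −i q^{1/8} u^{1/2} ∏_{n≥1} (1 − u⁻¹qⁿ⁻¹)(1 − uqⁿ)(1 − qⁿ)`. -/
def theta1 (τ z : ℂ) : ℂ :=
  -I * exp (2 * ↑Real.pi * I * τ / 8) * exp (↑Real.pi * I * z) *
    ∏' n : ℕ, ((1 - (qq z)⁻¹ * qq τ ^ n) * (1 - qq z * qq τ ^ (n + 1)) * (1 - qq τ ^ (n + 1)))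

/-- `θ₂(τ,z) = q^{1/8} u^{1/2} ∏_{n≥1} (1 + u⁻¹qⁿ⁻¹)(1 + uqⁿ)(1 − qⁿ)`. -/
def theta2 (τ z : ℂ) : ℂ :=
  exp (2 * ↑Real.pi * I * τ / 8) * exp (↑Real.pi * I * z) *
    ∏' n : ℕ, ((1 + (qq z)⁻¹ * qq τ ^ n) * (1 + qq z * qq τ ^ (n + 1)) * (1 - qq τ ^ (n + 1)))

/-- `θ₃(τ,z) = ∏_{n≥1} (1 + u⁻¹qⁿ⁻¹ᐟ²)(1 + uqⁿ⁻¹ᐟ²)(1 − qⁿ)`. -/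
def theta3 (τ z : ℂ) : ℂ :=
  ∏' n : ℕ, ((1 + (qq z)⁻¹ * exp (2 * ↑Real.pi * I * τ * ((n : ℂ) + 1 / 2))) *
    (1 + qq z * exp (2 * ↑Real.pi * I * τ * ((n : ℂ) + 1 / 2))) * (1 - qq τ ^ (n + 1)))

/-- `θ₄(τ,z) = ∏_{n≥1} (1 − u⁻¹qⁿ⁻¹ᐟ²)(1 − uqⁿ⁻¹ᐟ²)(1 − qⁿ)`. -/
def theta4 (τ z : ℂ) : ℂ :=
  ∏' n : ℕ, ((1 - (qq z)⁻¹ * exp (2 * ↑Real.pi * I * τ * ((n : ℂ) + 1 / 2))) *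
    (1 - qq z * exp (2 * ↑Real.pi * I * τ * ((n : ℂ) + 1 / 2))) * (1 - qq τ ^ (n + 1)))

/-- `Ψ_{1,1}(τ,z) = −i θ₁(τ,2z) η(τ)³ / θ₁(τ,z)²`. -/
def Psi11 (τ z : ℂ) : ℂ := -I * theta1 τ (2 * z) * dedekindEta τ ^ 3 / theta1 τ z ^ 2

/-- `μ_{m,0}(τ,z) = ∑_{k∈ℤ} u^{2km} q^{mk²} (uq^k + 1)/(uq^k − 1)`. -/
def mu (m : ℕ) (τ z : ℂ) : ℂ :=
  ∑' k : ℤ, qq z ^ (2 * k * (m : ℤ)) * qq τ ^ ((m : ℤ) * k ^ 2) *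
    ((qq z * qq τ ^ k + 1) / (qq z * qq τ ^ k - 1))

/-- The index `m` theta function `θ_{m,r}(τ,z) = ∑_{k∈ℤ} u^{2mk+r} q^{(2mk+r)²/(4m)}`,
which depends only on `r` modulo `2m`. -/
def thetam (m : ℕ) (r : ℤ) (τ z : ℂ) : ℂ :=
  ∑' k : ℤ, qq z ^ (2 * (m : ℤ) * k + r) *
    exp (2 * ↑Real.pi * I * τ * (((2 * (m : ℤ) * k + r : ℤ) : ℂ) ^ 2 / (4 * (m : ℂ))))

/-- `φ^{(2)}_1(τ,z) = 4(θ₂(τ,z)²/θ₂(τ,0)² + θ₃(τ,z)²/θ₃(τ,0)² + θ₄(τ,z)²/θ₄(τ,0)²)`. -/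
def phi21 (τ z : ℂ) : ℂ :=
  4 * (theta2 τ z ^ 2 / theta2 τ 0 ^ 2 + theta3 τ z ^ 2 / theta3 τ 0 ^ 2 +
    theta4 τ z ^ 2 / theta4 τ 0 ^ 2)

open Filter Topology Set

/-- The infinite product `∏_{n ≥ 0} (1 - w qⁿ)`. -/
def qPoch (q w : ℂ) : ℂ := ∏' n : ℕ, (1 - w * q ^ n)

section qPoch

variable {q : ℂ}

lemma summable_norm_mul_pow (hq : ‖q‖ < 1) (w : ℂ) : Summable fun n : ℕ => ‖-(w * q ^ n)‖ := by
  simpa using (summable_geometric_of_lt_one (norm_nonneg _) hq).mul_left ‖w‖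

lemma multipliable_one_sub_mul_pow (hq : ‖q‖ < 1) (w : ℂ) :
    Multipliable fun n : ℕ => 1 - w * q ^ n := by
  simpa [sub_eq_add_neg] using multipliable_one_add_of_summable (summable_norm_mul_pow hq w)

lemma qPoch_eq_mul (hq : ‖q‖ < 1) (w : ℂ) : qPoch q w = (1 - w) * qPoch q (w * q) := by
  have h : Multipliable fun n : ℕ => 1 - w * q ^ (n + 1) := by
    simpa [pow_succ', mul_assoc] using multipliable_one_sub_mul_pow hq (w * q)
  have e := tprod_eq_zero_mul' (f := fun n : ℕ => 1 - w * q ^ n) h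
  simp only [pow_zero, mul_one, pow_succ', ← mul_assoc] at e
  exact e

lemma qPoch_ne_zero (hq : ‖q‖ < 1) {w : ℂ} (hw : ∀ n : ℕ, w * q ^ n ≠ 1) : qPoch q w ≠ 0 := by
  have := tprod_one_add_ne_zero_of_summable (f := fun n : ℕ => -(w * q ^ n))
    (fun n => by simpa [← sub_eq_add_neg, sub_eq_zero] using (hw n).symm)
    (summable_norm_mul_pow hq w)
  simpa [qPoch, sub_eq_add_neg] using this

lemma differentiable_qPoch (hq : ‖q‖ < 1) : Differentiable ℂ (qPoch q) := by
  intro w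
  have hu : Summable fun n : ℕ => (‖w‖ + 1) * ‖q‖ ^ n :=
    (summable_geometric_of_lt_one (norm_nonneg _) hq).mul_left _
  have hp := hu.hasProdLocallyUniformlyOn_nat_one_add (f := fun n (x : ℂ) => -(x * q ^ n))
    (K := Metric.ball 0 (‖w‖ + 1)) Metric.isOpen_ball
    (Eventually.of_forall fun n x hx => by
      rw [norm_neg, norm_mul, norm_pow]
      gcongr
      exact (mem_ball_zero_iff.1 hx).le)
    (fun n => by fun_prop)
  have hd := hp.differentiableOn
    (.of_forall fun _ => by
      simpa [Finset.prod_fn] using DifferentiableOn.finsetProd (fun _ _ => by fun_prop))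
    Metric.isOpen_ball
  have := hd.differentiableAt (Metric.isOpen_ball.mem_nhds (show w ∈ Metric.ball 0 _ by simp))
  have he : qPoch q = fun x => ∏' n : ℕ, (1 + -(x * q ^ n)) := by
    funext x
    simp [qPoch, sub_eq_add_neg]
  rw [he]
  exact this

lemma tprod_eq_qPoch_mul (hq : ‖q‖ < 1) (a b c : ℂ) :
    ∏' n : ℕ, ((1 - a * q ^ n) * (1 - b * q ^ n) * (1 - c * q ^ n))
      = qPoch q a * qPoch q b * qPoch q c := by
  have ha := multipliable_one_sub_mul_pow hq a
  have hb := multipliable_one_sub_mul_pow hq b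
  have hc := multipliable_one_sub_mul_pow hq c
  rw [(ha.mul hb).tprod_mul hc, ha.tprod_mul hb]
  rfl

/-- The theta product `∏_{n ≥ 1} (1 - a⁻¹ qⁿ⁻¹) (1 - a qⁿ)`. -/
def thetaProd (q a : ℂ) : ℂ := qPoch q a⁻¹ * qPoch q (a * q)

lemma thetaProd_mul (hq : ‖q‖ < 1) (hq0 : q ≠ 0) {a : ℂ} (ha : a ≠ 0) :
    thetaProd q (a * q) = -(a * q)⁻¹ * thetaProd q a := by
  unfold thetaProd
  rw [qPoch_eq_mul hq (a * q)⁻¹, qPoch_eq_mul hq (a * q)]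
  have h : (a * q)⁻¹ * q = a⁻¹ := by field_simp
  rw [h]
  field_simp
  ring

lemma thetaProd_ne_zero (hq : ‖q‖ < 1) {a : ℂ} (ha : ∀ k : ℤ, a ≠ q ^ k) :
    thetaProd q a ≠ 0 := by
  have ha0 : a ≠ 0 ∨ a = 0 := ne_or_eq a 0
  refine mul_ne_zero (qPoch_ne_zero hq fun n h => ?_) (qPoch_ne_zero hq fun n h => ?_)
  · rcases ha0 with h0 | rfl
    · refine ha n ?_
      field_simp at h
      simpa using h.symm
    · simp at h
  · refine ha (-(n + 1 : ℕ)) ?_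
    rw [zpow_neg, zpow_natCast, pow_succ']
    exact eq_inv_of_mul_eq_one_left (by rw [← h]; ring)

lemma thetaProd_eq (hq : ‖q‖ < 1) (a : ℂ) :
    thetaProd q a = (1 - a⁻¹) * (qPoch q (a⁻¹ * q) * qPoch q (a * q)) := by
  rw [thetaProd, qPoch_eq_mul hq a⁻¹, mul_assoc]

lemma differentiableAt_thetaProd (hq : ‖q‖ < 1) {a : ℂ} (ha : a ≠ 0) :
    DifferentiableAt ℂ (thetaProd q) a := by
  have h := differentiable_qPoch hq
  exact ((h _).comp a (differentiableAt_inv ha)).mul ((h _).comp a (by fun_prop))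

lemma qPoch_self_ne_zero (hq : ‖q‖ < 1) : qPoch q q ≠ 0 := by
  refine qPoch_ne_zero hq fun n h => ?_
  have h1 : ‖q ^ (n + 1)‖ = 1 := by rw [pow_succ', h, norm_one]
  rw [norm_pow] at h1
  exact (pow_lt_one₀ (norm_nonneg _) hq n.succ_ne_zero).ne h1

end qPoch

section thetaFunctions

variable {τ : ℂ}

lemma qq_ne_zero (z : ℂ) : qq z ≠ 0 := exp_ne_zero _

lemma qq_add (z w : ℂ) : qq (z + w) = qq z * qq w := by
  rw [qq, mul_add, exp_add]; rfl

lemma qq_int_mul (k : ℤ) (z : ℂ) : qq (k * z) = qq z ^ k := by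
  rw [qq, qq, ← exp_int_mul]; ring_nf

lemma qq_int (k : ℤ) : qq k = 1 := by
  rw [qq, exp_eq_one_iff]; exact ⟨k, by ring⟩

lemma qq_eq_one_iff (z : ℂ) : qq z = 1 ↔ ∃ k : ℤ, z = k := by
  rw [qq, exp_eq_one_iff]
  refine exists_congr fun k => ?_
  rw [mul_comm (k : ℂ), mul_right_inj' two_pi_I_ne_zero]

lemma norm_qq (z : ℂ) : ‖qq z‖ = Real.exp (-2 * Real.pi * z.im) := by
  simp [qq, norm_exp]

lemma norm_qq_lt_one (hτ : 0 < τ.im) : ‖qq τ‖ < 1 := by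
  rw [norm_qq, Real.exp_lt_one_iff]
  nlinarith [Real.pi_pos]

lemma differentiable_qq : Differentiable ℂ qq := by
  unfold qq; fun_prop

lemma theta1_eq (hτ : 0 < τ.im) (z : ℂ) :
    theta1 τ z = -I * exp (2 * ↑Real.pi * I * τ / 8) * exp (↑Real.pi * I * z) *
      (thetaProd (qq τ) (qq z) * qPoch (qq τ) (qq τ)) := by
  rw [theta1, thetaProd, ← tprod_eq_qPoch_mul (norm_qq_lt_one hτ)]
  simp only [pow_succ', mul_assoc]

lemma theta2_eq (hτ : 0 < τ.im) (z : ℂ) :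
    theta2 τ z = exp (2 * ↑Real.pi * I * τ / 8) * exp (↑Real.pi * I * z) *
      (thetaProd (qq τ) (-qq z) * qPoch (qq τ) (qq τ)) := by
  rw [theta2, thetaProd, ← tprod_eq_qPoch_mul (norm_qq_lt_one hτ)]
  simp only [pow_succ', mul_assoc, inv_neg, neg_mul, sub_neg_eq_add]

lemma exp_half_add (τ : ℂ) (n : ℕ) :
    exp (2 * ↑Real.pi * I * τ * ((n : ℂ) + 1 / 2)) = qq (τ / 2) * qq τ ^ n := by
  rw [qq, qq, ← exp_nat_mul, ← exp_add]; ring_nf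

lemma qq_half_sq (τ : ℂ) : qq (τ / 2) * qq (τ / 2) = qq τ := by
  rw [← qq_add, add_halves]

lemma theta3_eq (hτ : 0 < τ.im) (z : ℂ) :
    theta3 τ z = thetaProd (qq τ) (-(qq z * (qq (τ / 2))⁻¹)) * qPoch (qq τ) (qq τ) := by
  rw [theta3, thetaProd, ← tprod_eq_qPoch_mul (norm_qq_lt_one hτ)]
  refine tprod_congr fun n => ?_
  rw [exp_half_add, ← qq_half_sq τ]
  have := qq_ne_zero (τ / 2)
  have := qq_ne_zero z
  field_simp
  ring

lemma theta4_eq (hτ : 0 < τ.im) (z : ℂ) :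
    theta4 τ z = thetaProd (qq τ) (qq z * (qq (τ / 2))⁻¹) * qPoch (qq τ) (qq τ) := by
  rw [theta4, thetaProd, ← tprod_eq_qPoch_mul (norm_qq_lt_one hτ)]
  refine tprod_congr fun n => ?_
  rw [exp_half_add, ← qq_half_sq τ]
  have := qq_ne_zero (τ / 2)
  have := qq_ne_zero z
  field_simp
  ring

lemma dedekindEta_eq (τ : ℂ) :
    dedekindEta τ = exp (2 * ↑Real.pi * I * τ / 24) * qPoch (qq τ) (qq τ) := by
  simp only [dedekindEta, qPoch, pow_succ']

lemma Psi11_eq (hτ : 0 < τ.im) (z : ℂ) :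
    Psi11 τ z = thetaProd (qq τ) (qq z ^ 2) * qPoch (qq τ) (qq τ) ^ 2 /
      thetaProd (qq τ) (qq z) ^ 2 := by
  have hP := qPoch_self_ne_zero (norm_qq_lt_one hτ)
  have h24 : exp (2 * ↑Real.pi * I * τ / 24) ^ 3 = exp (2 * ↑Real.pi * I * τ / 8) := by
    rw [← exp_nat_mul]; ring_nf
  have h2 : exp (↑Real.pi * I * (2 * z)) = exp (↑Real.pi * I * z) ^ 2 := by
    rw [← exp_nat_mul]; ring_nf
  have hz : qq (2 * z) = qq z ^ 2 := by rw [two_mul, qq_add, sq]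
  rw [Psi11, theta1_eq hτ, theta1_eq hτ, dedekindEta_eq, mul_pow, h24, h2, hz]
  have h8 := exp_ne_zero (2 * ↑Real.pi * I * τ / 8)
  have hz0 := exp_ne_zero (↑Real.pi * I * z)
  rcases eq_or_ne (thetaProd (qq τ) (qq z)) 0 with h0 | h0
  · simp [h0]
  · field_simp

lemma sq_exp_half (z : ℂ) : exp (↑Real.pi * I * z) ^ 2 = qq z := by
  rw [← exp_nat_mul, qq]; ring_nf

lemma phi21_eq (hτ : 0 < τ.im) (z : ℂ) :
    phi21 τ z = 4 * (qq z * (thetaProd (qq τ) (-qq z) / thetaProd (qq τ) (-1)) ^ 2 +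
      (thetaProd (qq τ) (-(qq z * (qq (τ / 2))⁻¹)) / thetaProd (qq τ) (-(qq (τ / 2))⁻¹)) ^ 2 +
      (thetaProd (qq τ) (qq z * (qq (τ / 2))⁻¹) / thetaProd (qq τ) (qq (τ / 2))⁻¹) ^ 2) := by
  have hP := qPoch_self_ne_zero (norm_qq_lt_one hτ)
  have h8 := exp_ne_zero (2 * ↑Real.pi * I * τ / 8)
  have h0 : qq 0 = 1 := by simp [qq]
  rw [phi21, theta2_eq hτ, theta2_eq hτ, theta3_eq hτ, theta3_eq hτ, theta4_eq hτ, theta4_eq hτ,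
    h0, one_mul, ← sq_exp_half z]
  simp only [mul_zero, exp_zero, mul_one, mul_pow, div_pow]
  have e (a b c : ℂ) (hc : c ≠ 0) : a * c / (b * c) = a / b := mul_div_mul_right a b hc
  rw [e _ _ _ (pow_ne_zero 2 hP), e _ _ _ (pow_ne_zero 2 hP)]
  congr 3
  field_simp

end thetaFunctions

section ellipticity

variable {τ : ℂ}

/-- The points of `ℂ` outside the lattice `ℤτ + ℤ`. -/
def latticeCompl (τ : ℂ) : Set ℂ := {z | ∀ a b : ℤ, z ≠ (a : ℂ) * τ + (b : ℂ)}

lemma mem_latticeCompl_iff {z : ℂ} :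
    z ∈ latticeCompl τ ↔ ∀ k : ℤ, qq z * qq τ ^ k ≠ 1 := by
  simp only [← qq_int_mul, ← qq_add, ne_eq, qq_eq_one_iff, not_exists]
  refine ⟨fun h k b e => h (-k) b ?_, fun h a b e => h (-a) b ?_⟩
  · push_cast; linear_combination e
  · push_cast; linear_combination e

lemma qq_ne_zpow {z : ℂ} (hz : z ∈ latticeCompl τ) (k : ℤ) : qq z ≠ qq τ ^ k := by
  intro h
  refine mem_latticeCompl_iff.1 hz (-k) ?_
  rw [h, zpow_neg, mul_inv_cancel₀ (zpow_ne_zero _ (qq_ne_zero _))]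

lemma thetaProd_qq_ne_zero (hτ : 0 < τ.im) {z : ℂ} (hz : z ∈ latticeCompl τ) :
    thetaProd (qq τ) (qq z) ≠ 0 :=
  thetaProd_ne_zero (norm_qq_lt_one hτ) (qq_ne_zpow hz)

lemma qq_add_one (z : ℂ) : qq (z + 1) = qq z := by
  rw [qq_add, show (1 : ℂ) = ((1 : ℤ) : ℂ) by simp, qq_int, mul_one]

lemma Psi11_add_one (hτ : 0 < τ.im) (z : ℂ) : Psi11 τ (z + 1) = Psi11 τ z := by
  simp only [Psi11_eq hτ, qq_add_one]

lemma phi21_add_one (hτ : 0 < τ.im) (z : ℂ) : phi21 τ (z + 1) = phi21 τ z := by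
  simp only [phi21_eq hτ, qq_add_one]

lemma mu_add_one (m : ℕ) (z : ℂ) : mu m τ (z + 1) = mu m τ z := by
  simp only [mu, qq_add_one]

lemma Psi11_add_tau (hτ : 0 < τ.im) (z : ℂ) :
    Psi11 τ (z + τ) = (qq z ^ 2 * qq τ)⁻¹ * Psi11 τ z := by
  have hq := norm_qq_lt_one hτ
  have hq0 := qq_ne_zero τ
  have hz0 := qq_ne_zero z
  have e : (qq z * qq τ) ^ 2 = qq z ^ 2 * qq τ * qq τ := by ring
  rw [Psi11_eq hτ, Psi11_eq hτ, qq_add, e, thetaProd_mul hq hq0 (by positivity),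
    thetaProd_mul hq hq0 (by positivity), thetaProd_mul hq hq0 hz0]
  rcases eq_or_ne (thetaProd (qq τ) (qq z)) 0 with h0 | h0
  · simp [h0]
  · field_simp

lemma phi21_add_tau (hτ : 0 < τ.im) (z : ℂ) :
    phi21 τ (z + τ) = (qq z ^ 2 * qq τ)⁻¹ * phi21 τ z := by
  have hq := norm_qq_lt_one hτ
  have hq0 := qq_ne_zero τ
  have hz0 := qq_ne_zero z
  have hh0 := qq_ne_zero (τ / 2)
  rw [phi21_eq hτ, phi21_eq hτ, qq_add,
    show -(qq z * qq τ) = -qq z * qq τ by ring,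
    show -(qq z * qq τ * (qq (τ / 2))⁻¹) = -(qq z * (qq (τ / 2))⁻¹) * qq τ by ring,
    show qq z * qq τ * (qq (τ / 2))⁻¹ = qq z * (qq (τ / 2))⁻¹ * qq τ by ring,
    thetaProd_mul hq hq0 (neg_ne_zero.2 hz0),
    thetaProd_mul hq hq0 (neg_ne_zero.2 (mul_ne_zero hz0 (inv_ne_zero hh0))),
    thetaProd_mul hq hq0 (mul_ne_zero hz0 (inv_ne_zero hh0))]
  have hs : qq τ = qq (τ / 2) ^ 2 := by rw [sq, qq_half_sq]
  simp only [mul_div_assoc, mul_pow]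
  generalize thetaProd (qq τ) (-qq z) / thetaProd (qq τ) (-1) = A
  generalize thetaProd (qq τ) (-(qq z * (qq (τ / 2))⁻¹)) /
    thetaProd (qq τ) (-(qq (τ / 2))⁻¹) = B
  generalize thetaProd (qq τ) (qq z * (qq (τ / 2))⁻¹) / thetaProd (qq τ) (qq (τ / 2))⁻¹ = C
  rw [hs]
  field_simp

lemma mu_two_add_tau (z : ℂ) :
    mu 2 τ (z + τ) = (qq z ^ 4 * qq τ ^ 2)⁻¹ * mu 2 τ z := by
  have hq0 := qq_ne_zero τ
  have hz0 := qq_ne_zero z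
  unfold mu
  rw [← tsum_mul_left, ← (Equiv.addRight (1 : ℤ)).tsum_eq fun k : ℤ => (qq z ^ 4 * qq τ ^ 2)⁻¹ * _]
  refine tsum_congr fun k => ?_
  rw [qq_add, Equiv.coe_addRight, mul_assoc (qq z) (qq τ), ← zpow_one_add₀ hq0, add_comm 1 k,
    ← mul_assoc]
  congr 1
  rw [mul_zpow, show 2 * (k + 1) * ((2 : ℕ) : ℤ) = 2 * k * ((2 : ℕ) : ℤ) + 4 by push_cast; ring,
    show ((2 : ℕ) : ℤ) * (k + 1) ^ 2 = ((2 : ℕ) : ℤ) * k ^ 2 + 2 * k * ((2 : ℕ) : ℤ) + 2 by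
      push_cast; ring, zpow_add₀ hz0, zpow_add₀ hq0, zpow_add₀ hq0]
  norm_cast
  field_simp

lemma differentiable_phi21 (hτ : 0 < τ.im) : Differentiable ℂ (phi21 τ) := by
  have hq := norm_qq_lt_one hτ
  have hT {f : ℂ → ℂ} (hf : Differentiable ℂ f) (h0 : ∀ z, f z ≠ 0) :
      Differentiable ℂ fun z => thetaProd (qq τ) (f z) := fun z =>
    (differentiableAt_thetaProd hq (h0 z)).comp z (hf z)
  have hqq := differentiable_qq
  have hh0 := qq_ne_zero (τ / 2)
  have h2 := hT (f := fun z => -qq z) (by fun_prop) fun z => neg_ne_zero.2 (qq_ne_zero z)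
  have h3 := hT (f := fun z => -(qq z * (qq (τ / 2))⁻¹)) (by fun_prop) fun z =>
    neg_ne_zero.2 (mul_ne_zero (qq_ne_zero z) (inv_ne_zero hh0))
  have h4 := hT (f := fun z => qq z * (qq (τ / 2))⁻¹) (by fun_prop) fun z =>
    mul_ne_zero (qq_ne_zero z) (inv_ne_zero hh0)
  rw [funext (phi21_eq hτ)]
  fun_prop

lemma differentiableAt_Psi11 (hτ : 0 < τ.im) {z : ℂ} (hz : z ∈ latticeCompl τ) :
    DifferentiableAt ℂ (Psi11 τ) z := by
  have hq := norm_qq_lt_one hτ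
  have hqq := differentiable_qq
  rw [funext (Psi11_eq hτ)]
  have h1 : DifferentiableAt ℂ (fun z => thetaProd (qq τ) (qq z ^ 2)) z :=
    DifferentiableAt.comp (g := thetaProd (qq τ)) (f := fun z => qq z ^ 2) z
      (differentiableAt_thetaProd hq (pow_ne_zero 2 (qq_ne_zero z))) (by fun_prop)
  have h2 : DifferentiableAt ℂ (fun z => thetaProd (qq τ) (qq z)) z :=
    DifferentiableAt.comp (g := thetaProd (qq τ)) (f := qq) z
      (differentiableAt_thetaProd hq (qq_ne_zero z)) (by fun_prop)
  exact (h1.mul_const _).div (h2.pow 2) (pow_ne_zero 2 (thetaProd_qq_ne_zero hτ hz))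

lemma phi21_zero (hτ : 0 < τ.im) : phi21 τ 0 = 12 := by
  have hq := norm_qq_lt_one hτ
  have hn (k : ℤ) : ‖qq τ ^ k‖ = Real.exp (-2 * Real.pi * (k * τ.im)) := by
    rw [← qq_int_mul, norm_qq]; simp
  have hh : ‖(qq (τ / 2))⁻¹‖ = Real.exp (Real.pi * τ.im) := by
    rw [norm_inv, norm_qq, ← Real.exp_neg]; congr 1; simp; ring
  have key (k : ℤ) : Real.exp (Real.pi * τ.im) ≠ ‖qq τ ^ k‖ := by
    rw [hn, Ne, Real.exp_eq_exp]
    intro h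
    have h1 : (Real.pi * τ.im) * (2 * k + 1) = 0 := by linear_combination h
    rcases mul_eq_zero.1 h1 with h2 | h2
    · exact (mul_pos Real.pi_pos hτ).ne' h2
    · norm_cast at h2; omega
  have h2 : thetaProd (qq τ) (-1) ≠ 0 := by
    refine thetaProd_ne_zero hq fun k h => ?_
    have h1 := congrArg norm h
    rw [hn, norm_neg, norm_one, eq_comm, Real.exp_eq_one_iff] at h1
    have hk : k = 0 := by
      have : (k : ℝ) = 0 := by
        have := Real.pi_pos.ne'
        have := hτ.ne'
        simpa [*] using h1
      exact_mod_cast this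
    subst hk
    norm_num at h
  have h3 : thetaProd (qq τ) (-(qq (τ / 2))⁻¹) ≠ 0 :=
    thetaProd_ne_zero hq fun k h => key k (by rw [← h, norm_neg, hh])
  have h4 : thetaProd (qq τ) (qq (τ / 2))⁻¹ ≠ 0 :=
    thetaProd_ne_zero hq fun k h => key k (by rw [← h, hh])
  have h0 : qq 0 = 1 := by simp [qq]
  rw [phi21_eq hτ, h0, one_mul, one_mul, div_self h2, div_self h3, div_self h4]
  norm_num

lemma tendsto_Psi11_zero (hτ : 0 < τ.im) :
    Tendsto (fun z => (qq z - 1) * Psi11 τ z) (𝓝[latticeCompl τ] 0) (𝓝 2) := by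
  have hq := norm_qq_lt_one hτ
  have hP := qPoch_self_ne_zero hq
  have h0 : qq 0 = 1 := by simp [qq]
  have hc := (differentiable_qPoch hq).continuous
  have hqc : ContinuousAt qq 0 := differentiable_qq.continuous.continuousAt
  let S : ℂ → ℂ := fun u => qPoch (qq τ) (u⁻¹ * qq τ) * qPoch (qq τ) (u * qq τ)
  have hS : ContinuousAt S 1 := by
    have hi : ContinuousAt (fun u : ℂ => u⁻¹) 1 := continuousAt_inv₀ one_ne_zero
    exact (hc.continuousAt.comp (hi.mul_const _)).mul
      (hc.continuousAt.comp (continuousAt_id.mul_const _))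
  have hS1 : S 1 = qPoch (qq τ) (qq τ) ^ 2 := by simp [S, sq]
  have hG : ContinuousAt (fun z => (qq z + 1) * (S (qq z ^ 2) * qPoch (qq τ) (qq τ) ^ 2) /
      S (qq z) ^ 2) 0 := by
    have e1 : ContinuousAt (fun z => S (qq z ^ 2)) 0 :=
      ContinuousAt.comp (g := S) (f := fun z => qq z ^ 2) (by simpa [h0] using hS) (hqc.pow 2)
    have e2 : ContinuousAt (fun z => S (qq z)) 0 :=
      ContinuousAt.comp (g := S) (f := qq) (by simpa [h0] using hS) hqc
    refine ((hqc.add_const 1).mul (e1.mul_const _)).div (e2.pow 2) ?_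
    rw [h0, hS1]
    positivity
  have hG0 := hG.tendsto
  simp only [h0, one_pow, hS1] at hG0
  have ev : (1 + 1) * (qPoch (qq τ) (qq τ) ^ 2 * qPoch (qq τ) (qq τ) ^ 2) /
      (qPoch (qq τ) (qq τ) ^ 2) ^ 2 = (2 : ℂ) := by
    field_simp; norm_num
  rw [ev] at hG0
  refine (hG0.mono_left nhdsWithin_le_nhds).congr' ?_
  filter_upwards [self_mem_nhdsWithin] with z hz
  have hu0 := qq_ne_zero z
  have hu1 : qq z - 1 ≠ 0 := by
    have := mem_latticeCompl_iff.1 hz 0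
    simpa [sub_eq_zero] using this
  have hT := thetaProd_qq_ne_zero hτ hz
  rw [thetaProd_eq hq] at hT
  have hSz : S (qq z) ≠ 0 := right_ne_zero_of_mul hT
  rw [Psi11_eq hτ, thetaProd_eq hq, thetaProd_eq hq]
  change _ = (qq z - 1) * ((1 - (qq z ^ 2)⁻¹) * S (qq z ^ 2) * _ / ((1 - (qq z)⁻¹) * S (qq z)) ^ 2)
  have e1 : 1 - (qq z)⁻¹ = (qq z - 1) * (qq z)⁻¹ := by field_simp
  have e2 : 1 - (qq z ^ 2)⁻¹ = (qq z - 1) * (qq z + 1) * (qq z)⁻¹ ^ 2 := by field_simp; ring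
  rw [e1, e2]
  field_simp

end ellipticity

section appellLerch

variable {τ : ℂ}

lemma eventually_le_norm_qq_mul_zpow_sub_one (hτ : 0 < τ.im) {S : Set ℤ} {z₀ : ℂ}
    (h : ∀ k ∈ S, qq z₀ * qq τ ^ k ≠ 1) :
    ∃ δ > 0, ∀ᶠ z in 𝓝 z₀, ∀ k ∈ S, δ ≤ ‖qq z * qq τ ^ k - 1‖ := by
  obtain ⟨K, hK⟩ := exists_nat_gt ((|z₀.im| + 2) / τ.im)
  rw [div_lt_iff₀ hτ] at hK
  have hfin : (S ∩ Icc (-(K : ℤ)) K).Finite := (finite_Icc _ _).inter_of_right _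
  have h1 : ∀ᶠ δ in 𝓝[>] (0 : ℝ), ∀ k ∈ S ∩ Icc (-(K : ℤ)) K, δ < ‖qq z₀ * qq τ ^ k - 1‖ := by
    rw [eventually_all_finite hfin]
    intro k hk
    have : 0 < ‖qq z₀ * qq τ ^ k - 1‖ := norm_pos_iff.2 (sub_ne_zero.2 (h k hk.1))
    exact nhdsWithin_le_nhds (eventually_lt_nhds this)
  have h2 : ∀ᶠ δ in 𝓝[>] (0 : ℝ), δ < 1 / 2 :=
    nhdsWithin_le_nhds (eventually_lt_nhds (by norm_num))
  obtain ⟨δ, ⟨hδ1, hδ2⟩, hδ⟩ := ((h1.and h2).and self_mem_nhdsWithin).exists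
  refine ⟨δ, hδ, ?_⟩
  have h3 : ∀ᶠ z in 𝓝 z₀, ∀ k ∈ S ∩ Icc (-(K : ℤ)) K, δ < ‖qq z * qq τ ^ k - 1‖ := by
    rw [eventually_all_finite hfin]
    intro k hk
    have hc : Continuous fun z => ‖qq z * qq τ ^ k - 1‖ :=
      ((differentiable_qq.continuous.mul continuous_const).sub continuous_const).norm
    exact hc.continuousAt.eventually (eventually_gt_nhds (hδ1 k hk))
  have h4 : ∀ᶠ z in 𝓝 z₀, |z.im| < |z₀.im| + 1 :=
    (continuous_im.abs.continuousAt (x := z₀)).eventually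
      (eventually_lt_nhds (by simp))
  filter_upwards [h3, h4] with z hz3 hz4 k hk
  by_cases hkK : k ∈ Icc (-(K : ℤ)) K
  · exact (hz3 k ⟨hk, hkK⟩).le
  have hn : ‖qq z * qq τ ^ k‖ = Real.exp (-2 * Real.pi * (z.im + k * τ.im)) := by
    rw [← qq_int_mul, ← qq_add, norm_qq]; simp
  have hpi := Real.pi_gt_three
  have hz5 := abs_lt.1 hz4
  rw [mem_Icc, not_and_or, not_le, not_le] at hkK
  rcases hkK with hk1 | hk1
  · have hk2 : (k : ℝ) ≤ -K := by exact_mod_cast hk1.le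
    have h6 : (k : ℝ) * τ.im ≤ -K * τ.im := by gcongr
    have h7 : (2 : ℝ) ≤ ‖qq z * qq τ ^ k‖ := by
      rw [hn]
      refine le_trans ?_ (Real.add_one_le_exp _)
      nlinarith
    have := norm_sub_norm_le (qq z * qq τ ^ k) 1
    rw [norm_one] at this
    linarith
  · have hk2 : (K : ℝ) ≤ k := by exact_mod_cast hk1.le
    have h6 : (K : ℝ) * τ.im ≤ k * τ.im := by gcongr
    have h7 : ‖qq z * qq τ ^ k‖ ≤ 1 / 2 := by
      rw [hn, one_div, show -2 * Real.pi * (z.im + k * τ.im)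
        = -(2 * Real.pi * (z.im + k * τ.im)) by ring, Real.exp_neg]
      refine inv_anti₀ two_pos (le_trans ?_ (Real.add_one_le_exp _))
      nlinarith
    have := norm_sub_norm_le 1 (qq z * qq τ ^ k)
    rw [norm_one, norm_sub_rev] at this
    linarith

/-- The summand of `mu 2`. -/
def muTerm (τ : ℂ) (k : ℤ) (z : ℂ) : ℂ :=
  qq z ^ (2 * k * ((2 : ℕ) : ℤ)) * qq τ ^ (((2 : ℕ) : ℤ) * k ^ 2) *
    ((qq z * qq τ ^ k + 1) / (qq z * qq τ ^ k - 1))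

lemma muTerm_coeff_eq (k : ℤ) (z : ℂ) :
    qq z ^ (2 * k * ((2 : ℕ) : ℤ)) * qq τ ^ (((2 : ℕ) : ℤ) * k ^ 2)
      = jacobiTheta₂_term k (4 * z) (4 * τ) := by
  rw [← qq_int_mul, ← qq_int_mul, ← qq_add, qq, jacobiTheta₂_term]
  congr 1
  push_cast
  ring

lemma differentiableAt_muTerm {k : ℤ} {z : ℂ} (h : qq z * qq τ ^ k ≠ 1) :
    DifferentiableAt ℂ (muTerm τ k) z := by
  have hqq := differentiable_qq
  have h1 : Differentiable ℂ fun z => qq z ^ (2 * k * ((2 : ℕ) : ℤ)) := by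
    simp only [← qq_int_mul]; fun_prop
  have h2 : qq z * qq τ ^ k - 1 ≠ 0 := sub_ne_zero.2 h
  have h3 : DifferentiableAt ℂ
      (fun z => (qq z * qq τ ^ k + 1) / (qq z * qq τ ^ k - 1)) z :=
    (((hqq z).mul_const _).add_const 1).div (((hqq z).mul_const _).sub_const 1) h2
  exact ((h1 z).mul_const _).mul h3

lemma differentiableAt_tsum_muTerm (hτ : 0 < τ.im) {S : Set ℤ} {z₀ : ℂ}
    (h : ∀ k ∈ S, qq z₀ * qq τ ^ k ≠ 1) :
    DifferentiableAt ℂ (fun z => ∑' k : S, muTerm τ k z) z₀ ∧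
      Summable fun k : S => muTerm τ k z₀ := by
  obtain ⟨δ, hδ, hev⟩ := eventually_le_norm_qq_mul_zpow_sub_one hτ h
  have h4 : ∀ᶠ z in 𝓝 z₀, |z.im| < |z₀.im| + 1 :=
    (continuous_im.abs.continuousAt (x := z₀)).eventually
      (eventually_lt_nhds (by simp))
  obtain ⟨U, hU, hUo, hzU⟩ := _root_.eventually_nhds_iff.1 (hev.and h4)
  have hT : 0 < (4 * τ).im := by simpa using hτ
  let B : ℤ → ℝ := fun k =>
    Real.exp (-Real.pi * ((4 * τ).im * k ^ 2 - 2 * (4 * (|z₀.im| + 1)) * |k|))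
  have hB : Summable B := by
    simpa [B] using summable_pow_mul_jacobiTheta₂_term_bound (4 * (|z₀.im| + 1)) hT 0
  have hsum : Summable fun k : S => (1 + 2 / δ) * B k :=
    (hB.mul_left (1 + 2 / δ)).comp_injective Subtype.val_injective
  have hne {z : ℂ} (hz : z ∈ U) (k : S) : qq z * qq τ ^ (k : ℤ) - 1 ≠ 0 := fun h0 => by
    have := (hU z hz).1 k k.2
    rw [h0, norm_zero] at this
    linarith
  have hb (k : S) (z : ℂ) (hz : z ∈ U) : ‖muTerm τ k z‖ ≤ (1 + 2 / δ) * B k := by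
    rw [muTerm, muTerm_coeff_eq, norm_mul, mul_comm]
    have e : (qq z * qq τ ^ (k : ℤ) + 1) / (qq z * qq τ ^ (k : ℤ) - 1)
        = 1 + 2 / (qq z * qq τ ^ (k : ℤ) - 1) := by
      have := hne hz k
      field_simp
      ring
    gcongr
    · rw [e]
      refine (norm_add_le _ _).trans ?_
      rw [norm_one, norm_div, Complex.norm_ofNat]
      gcongr
      exact (hU z hz).1 k k.2
    · refine norm_jacobiTheta₂_term_le hT ?_ le_rfl k
      have := (hU z hz).2
      have e4 : (4 * z).im = 4 * z.im := by simp
      rw [e4, abs_mul, abs_of_pos (by norm_num : (0 : ℝ) < 4)]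
      linarith
  refine ⟨?_, Summable.of_norm_bounded hsum fun k => hb k z₀ hzU⟩
  refine (Complex.differentiableOn_tsum_of_summable_norm hsum (fun k z hz => ?_) hUo
    hb).differentiableAt (hUo.mem_nhds hzU)
  exact (differentiableAt_muTerm (sub_ne_zero.1 (hne hz k))).differentiableWithinAt

lemma differentiableAt_mu_two (hτ : 0 < τ.im) {z : ℂ} (hz : z ∈ latticeCompl τ) :
    DifferentiableAt ℂ (mu 2 τ) z := by
  have := (differentiableAt_tsum_muTerm hτ (S := univ)
    fun k _ => mem_latticeCompl_iff.1 hz k).1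
  have e : mu 2 τ = fun z => ∑' k : (univ : Set ℤ), muTerm τ k z := by
    funext z
    rw [tsum_univ fun k => muTerm τ k z]
    rfl
  rwa [e]

lemma tendsto_mu_two_zero (hτ : 0 < τ.im) :
    Tendsto (fun z => (qq z - 1) * mu 2 τ z) (𝓝[latticeCompl τ] 0) (𝓝 2) := by
  have h0 : qq 0 = 1 := by simp [qq]
  have hne : ∀ k ∈ ({0} : Set ℤ)ᶜ, qq 0 * qq τ ^ k ≠ 1 := by
    intro k hk h
    have h1 := congrArg norm h
    rw [h0, one_mul, ← qq_int_mul, norm_qq, norm_one, Real.exp_eq_one_iff] at h1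
    have := Real.pi_pos.ne'
    have := hτ.ne'
    simp_all
  have hd := (differentiableAt_tsum_muTerm hτ hne).1.continuousAt
  have hqc : ContinuousAt qq 0 := differentiable_qq.continuous.continuousAt
  have hlim : Tendsto (fun z => (qq z + 1) + (qq z - 1) *
      ∑' k : (({0} : Set ℤ)ᶜ : Set ℤ), muTerm τ k z) (𝓝 0) (𝓝 ((qq 0 + 1) + (qq 0 - 1) *
      ∑' k : (({0} : Set ℤ)ᶜ : Set ℤ), muTerm τ k 0)) :=
    ((hqc.add_const 1).add ((hqc.sub_const 1).mul hd)).tendsto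
  rw [h0, sub_self, zero_mul, add_zero, one_add_one_eq_two] at hlim
  refine (hlim.mono_left nhdsWithin_le_nhds).congr' ?_
  filter_upwards [self_mem_nhdsWithin] with z hz
  have hz' := mem_latticeCompl_iff.1 hz
  have hu1 : qq z - 1 ≠ 0 := by simpa [sub_eq_zero] using hz' 0
  have hs := (differentiableAt_tsum_muTerm hτ (S := {0}ᶜ) fun k _ => hz' k).2
  have hs0 := (differentiableAt_tsum_muTerm hτ (S := {0}) fun k _ => hz' k).2
  have e : mu 2 τ z = muTerm τ 0 z + ∑' k : (({0} : Set ℤ)ᶜ : Set ℤ), muTerm τ k z := by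
    have := hs0.tsum_add_tsum_compl (f := fun k => muTerm τ k z) hs
    rw [tsum_singleton 0 fun k => muTerm τ k z] at this
    exact this.symm
  have e0 : muTerm τ 0 z = (qq z + 1) / (qq z - 1) := by simp [muTerm]
  rw [e, e0, mul_add, mul_div_cancel₀ _ hu1]

end appellLerch

section fourierSeries

lemma hasSum_fourier_of_periodic {f : ℝ → ℂ} (hf : Continuous f) (hp : Function.Periodic f 1)
    {c : ℤ → ℂ} (a : ℝ) (hc : ∀ n : ℤ, c n = ∫ x in a..a + 1, f x * qq (-n * x))
    (hs : Summable c) (x : ℝ) : HasSum (fun n : ℤ => c n * qq (n * x)) (f x) := by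
  let g : C(AddCircle (1 : ℝ), ℂ) := ⟨hp.lift, Continuous.quotient_liftOn' hf _⟩
  have hg (x : ℝ) : g (x : AddCircle (1 : ℝ)) = f x := hp.lift_coe x
  have hfour (n : ℤ) (x : ℝ) : fourier n (x : AddCircle (1 : ℝ)) = qq (n * x) := by
    rw [fourier_coe_apply, qq]; congr 1; simp; ring
  have hcoeff : fourierCoeff g = c := by
    funext n
    rw [fourierCoeff_eq_intervalIntegral g n a, hc]
    simp only [one_div, inv_one, one_smul, smul_eq_mul, hg, hfour]
    congr 1
    funext x
    push_cast
    ring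
  have := has_pointwise_sum_fourier_series_of_summable (f := g) (hcoeff ▸ hs) x
  simpa only [hcoeff, hg, hfour, smul_eq_mul] using this

lemma eq_zero_of_hasSum_qq {a : ℤ → ℂ} (ha : Summable fun n => ‖a n‖)
    (h : ∀ x : ℝ, HasSum (fun n : ℤ => a n * qq (n * x)) 0) (m : ℤ) : a m = 0 := by
  have hs : Summable fun n : ℤ => a n • (fourier n : C(AddCircle (1 : ℝ), ℂ)) := by
    refine Summable.of_norm ?_
    simpa [norm_smul, fourier_norm] using ha
  have h0 : HasSum (fun n : ℤ => a n • (fourier n : C(AddCircle (1 : ℝ), ℂ))) 0 := by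
    convert hs.hasSum using 1
    ext x
    induction x using QuotientAddGroup.induction_on with
    | H x =>
      have h1 := (ContinuousMap.evalCLM ℂ (x : AddCircle (1 : ℝ))).hasSum hs.hasSum
      have hfour (n : ℤ) : fourier n (x : AddCircle (1 : ℝ)) = qq (n * x) := by
        rw [fourier_coe_apply, qq]; congr 1; simp; ring
      refine (h x).unique ?_
      have e : (fun n : ℤ => a n * qq (n * x)) = fun n : ℤ =>
          (ContinuousMap.evalCLM ℂ (x : AddCircle (1 : ℝ))) (a n • (fourier n : C(_, ℂ))) := by
        funext n
        simp [← hfour]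
      rw [e]
      exact h1
  have h1 := (innerSL ℂ (fourierLp (T := (1 : ℝ)) 2 m)).hasSum
    ((ContinuousMap.toLp (E := ℂ) 2 (@AddCircle.haarAddCircle 1 _) ℂ).hasSum h0)
  have h2 : HasSum (fun n : ℤ => if n = m then a m else 0) 0 := by
    have e : (fun n : ℤ => if n = m then a m else 0) = fun n : ℤ =>
        innerSL ℂ (fourierLp (T := (1 : ℝ)) 2 m)
          (ContinuousMap.toLp (E := ℂ) 2 (@AddCircle.haarAddCircle 1 _) ℂ
            (a n • (fourier n : C(AddCircle (1 : ℝ), ℂ)))) := by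
      funext n
      have ho := orthonormal_iff_ite.1 (orthonormal_fourier (T := (1 : ℝ))) m n
      simp only [map_smul, innerSL_apply_apply, smul_eq_mul]
      change _ = a n * inner ℂ (fourierLp (T := (1 : ℝ)) 2 m) (fourierLp (T := (1 : ℝ)) 2 n)
      rw [ho]
      by_cases hn : n = m
      · simp [hn]
      · simp [hn, Ne.symm hn]
    rw [map_zero, map_zero] at h1
    rw [e]
    exact h1
  exact (hasSum_ite_eq m (a m)).unique h2

end fourierSeries

section thetaSeries

variable {τ : ℂ}

/-- The term `uⁿ q^{n²/8}` of the index two theta functions. -/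
def thetaTerm (τ : ℂ) (n : ℤ) (z : ℂ) : ℂ := qq (n * z + n ^ 2 / 8 * τ)

lemma thetaTerm_four_mul_add (k r : ℤ) (z : ℂ) :
    thetaTerm τ (4 * k + r) z
      = qq (r * z + r ^ 2 / 8 * τ) * jacobiTheta₂_term k (4 * z + r * τ) (4 * τ) := by
  rw [thetaTerm, qq, qq, jacobiTheta₂_term, ← exp_add]
  congr 1
  push_cast
  ring

lemma thetam_two_eq (r : ℤ) (z : ℂ) :
    thetam 2 r τ z = qq (r * z + r ^ 2 / 8 * τ) * jacobiTheta₂ (4 * z + r * τ) (4 * τ) := by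
  rw [thetam, jacobiTheta₂, ← tsum_mul_left]
  refine tsum_congr fun k => ?_
  rw [← thetaTerm_four_mul_add, thetaTerm, ← qq_int_mul, qq, qq, ← exp_add]
  congr 1
  push_cast
  ring

lemma differentiable_thetam_two (hτ : 0 < τ.im) (r : ℤ) : Differentiable ℂ (thetam 2 r τ) := by
  have hT : 0 < (4 * τ).im := by simpa using hτ
  intro z
  rw [funext (thetam_two_eq r)]
  have h1 : DifferentiableAt ℂ (fun z => qq (r * z + r ^ 2 / 8 * τ)) z :=
    DifferentiableAt.comp (g := qq) z (differentiable_qq _) (by fun_prop)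
  have h2 : DifferentiableAt ℂ (fun z => jacobiTheta₂ (4 * z + r * τ) (4 * τ)) z :=
    DifferentiableAt.comp (g := fun w => jacobiTheta₂ w (4 * τ)) z
      (differentiableAt_jacobiTheta₂_fst _ hT) (by fun_prop)
  exact h1.mul h2

lemma hasSum_thetam_two (hτ : 0 < τ.im) (r : ℤ) (z : ℂ) :
    HasSum (fun k : ℤ => thetaTerm τ (4 * k + r) z) (thetam 2 r τ z) := by
  have hT : 0 < (4 * τ).im := by simpa using hτ
  simp only [thetaTerm_four_mul_add, thetam_two_eq]
  exact (hasSum_jacobiTheta₂_term _ hT).mul_left _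

lemma hasSum_mul_thetaTerm (hτ : 0 < τ.im) (H : ZMod 4 → ℂ) (z : ℂ) :
    HasSum (fun n : ℤ => H n * thetaTerm τ n z) (∑ r : ZMod 4, H r * thetam 2 (r.val : ℤ) τ z) := by
  have key (r : ZMod 4) : HasSum (fun n : ℤ => if (n : ZMod 4) = r then H r * thetaTerm τ n z else 0)
      (H r * thetam 2 (r.val : ℤ) τ z) := by
    have hinj : Function.Injective fun k : ℤ => 4 * k + (r.val : ℤ) := fun a b h => by
      simpa using h
    rw [← hinj.hasSum_iff]
    · have h4 : (4 : ZMod 4) = 0 := rfl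
      have e : (fun n : ℤ => if (n : ZMod 4) = r then H r * thetaTerm τ n z else 0) ∘
          (fun k : ℤ => 4 * k + (r.val : ℤ)) =
          fun k : ℤ => H r * thetaTerm τ (4 * k + (r.val : ℤ)) z := by
        funext k
        simp [h4]
      rw [e]
      exact (hasSum_thetam_two hτ (r.val : ℤ) z).mul_left (H r)
    · intro n hn
      refine if_neg fun h => hn ?_
      have h1 : ((n - r.val : ℤ) : ZMod 4) = 0 := by simp [h]
      obtain ⟨k, hk⟩ := (ZMod.intCast_zmod_eq_zero_iff_dvd _ 4).1 h1
      exact ⟨k, by push_cast at hk; simp only; omega⟩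
  have e : (fun n : ℤ => H n * thetaTerm τ n z) = fun n : ℤ => ∑ r : ZMod 4,
      if (n : ZMod 4) = r then H r * thetaTerm τ n z else 0 := by
    funext n
    simp
  rw [e]
  exact hasSum_sum fun r (_ : r ∈ Finset.univ) => key r

end thetaSeries

section strip

variable {τ : ℂ}

lemma mem_latticeCompl_of_abs_lt (hτ : 0 < τ.im) {z : ℂ} (hre : |z.re| < 1) (him : |z.im| < τ.im)
    (hz : z ≠ 0) : z ∈ latticeCompl τ := by
  rintro a b rfl
  have ha : a = 0 := by
    have h1 : |(a : ℝ)| * τ.im < 1 * τ.im := by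
      simpa [abs_mul, abs_of_pos hτ] using him
    have h2 : |(a : ℝ)| < 1 := lt_of_mul_lt_mul_right h1 hτ.le
    exact Int.abs_lt_one_iff.1 (by exact_mod_cast h2)
  subst ha
  have hb : b = 0 := Int.abs_lt_one_iff.1 (by
    have : |(b : ℝ)| < 1 := by simpa using hre
    exact_mod_cast this)
  simp [hb] at hz

lemma mem_latticeCompl_of_im_eq (hτ : 0 < τ.im) {z : ℂ} (hz : z.im = -(τ.im / 2)) :
    z ∈ latticeCompl τ := by
  rintro a b rfl
  have h1 : (a : ℝ) * τ.im = -(τ.im / 2) := by simpa using hz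
  have h2 : ((2 * a + 1 : ℤ) : ℝ) * τ.im = 0 := by push_cast; linarith
  have h3 : 2 * a + 1 = 0 := by
    exact_mod_cast (mul_eq_zero.1 h2).resolve_right hτ.ne'
  omega

lemma isOpen_latticeCompl (hτ : 0 < τ.im) : IsOpen (latticeCompl τ) := by
  rw [isOpen_iff_mem_nhds]
  intro z₀ hz₀
  rw [mem_latticeCompl_iff] at hz₀
  obtain ⟨δ, hδ, h⟩ := eventually_le_norm_qq_mul_zpow_sub_one hτ (S := univ) fun k _ => hz₀ k
  filter_upwards [h] with z hz
  rw [mem_latticeCompl_iff]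
  intro k hk
  have := hz k (mem_univ k)
  rw [hk, sub_self, norm_zero] at this
  exact hδ.not_ge this

lemma isPreconnected_latticeCompl : IsPreconnected (latticeCompl τ) := by
  have h : latticeCompl τ = (range fun p : ℤ × ℤ => (p.1 : ℂ) * τ + p.2)ᶜ := by
    ext z
    simp [latticeCompl, eq_comm]
  rw [h]
  refine ((countable_range _).isConnected_compl_of_one_lt_rank ?_).isPreconnected
  rw [Complex.rank_real_complex]
  exact Cardinal.one_lt_two

lemma latticeCompl_mem_nhdsNE (hτ : 0 < τ.im) : latticeCompl τ ∈ 𝓝[≠] (0 : ℂ) := by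
  have h1 : ∀ᶠ z : ℂ in 𝓝 0, |z.re| < 1 :=
    (continuous_re.abs.continuousAt (x := (0 : ℂ))).eventually (eventually_lt_nhds (by simp))
  have h2 : ∀ᶠ z : ℂ in 𝓝 0, |z.im| < τ.im :=
    (continuous_im.abs.continuousAt (x := (0 : ℂ))).eventually (eventually_lt_nhds (by simpa))
  filter_upwards [nhdsWithin_le_nhds h1, nhdsWithin_le_nhds h2, self_mem_nhdsWithin] with z h1 h2 h3
  exact mem_latticeCompl_of_abs_lt hτ h1 h2 h3

lemma tendsto_div_qq_sub_one :
    Tendsto (fun z => z / (qq z - 1)) (𝓝[≠] 0) (𝓝 (2 * Real.pi * I)⁻¹) := by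
  have h : HasDerivAt qq (2 * Real.pi * I) 0 := by
    have := ((hasDerivAt_id (0 : ℂ)).const_mul (2 * Real.pi * I)).cexp
    simpa [qq] using! this
  have h1 := h.tendsto_slope.inv₀ two_pi_I_ne_zero
  refine h1.congr fun z => ?_
  simp [slope_def_field, qq]

lemma isLittleO_sub_inv (hτ : 0 < τ.im) {G : ℂ → ℂ}
    (h0 : Tendsto (fun z => (qq z - 1) * G z) (𝓝[latticeCompl τ] 0) (𝓝 0)) :
    (fun z => G z - G 0) =o[𝓝[≠] 0] fun z => (z - 0)⁻¹ := by
  have hle : 𝓝[≠] (0 : ℂ) ≤ 𝓝[latticeCompl τ] 0 :=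
    nhdsWithin_le_of_mem (latticeCompl_mem_nhdsNE hτ)
  have hne : ∀ᶠ z : ℂ in 𝓝[≠] 0, z ≠ 0 := self_mem_nhdsWithin
  rw [Asymptotics.isLittleO_iff_tendsto' (by
    filter_upwards [hne] with z hz h
    simp [hz] at h)]
  have hz : Tendsto (fun z : ℂ => z) (𝓝[≠] 0) (𝓝 0) := nhdsWithin_le_nhds
  have h1 := ((h0.mono_left hle).mul tendsto_div_qq_sub_one).sub (hz.const_mul (G 0))
  simp only [zero_mul, mul_zero, sub_zero] at h1
  refine h1.congr' ?_
  filter_upwards [latticeCompl_mem_nhdsNE hτ] with z hz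
  have h2 : qq z - 1 ≠ 0 := by
    simpa [sub_eq_zero] using mem_latticeCompl_iff.1 hz 0
  field_simp
  simp
  ring

lemma integral_strip_eq (hτ : 0 < τ.im) {G : ℂ → ℂ}
    (hd : ∀ z ∈ latticeCompl τ, DifferentiableAt ℂ G z) (h1 : ∀ z, G (z + 1) = G z)
    (h0 : Tendsto (fun z => (qq z - 1) * G z) (𝓝[latticeCompl τ] 0) (𝓝 0)) :
    ∫ x : ℝ in (-1 / 2)..(1 / 2), G (x + (-(τ.im / 2) : ℝ) * I)
      = ∫ x : ℝ in (-1 / 2)..(1 / 2), G (x + (τ.im / 2 : ℝ) * I) := by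
  set s : Set ℂ := {z | |z.re| < 1} ∩ {z | |z.im| < τ.im} with hs
  have hso : IsOpen s := (isOpen_lt continuous_re.abs continuous_const).inter
    (isOpen_lt continuous_im.abs continuous_const)
  have hs0 : s ∈ 𝓝 (0 : ℂ) := hso.mem_nhds (by simp [hs, hτ])
  have hdiff := differentiableOn_update_limUnder_of_isLittleO hs0 (f := G)
    (fun z hz => (hd z (mem_latticeCompl_of_abs_lt hτ hz.1.1 hz.1.2 hz.2)).differentiableWithinAt)
    (isLittleO_sub_inv hτ h0)
  set G₀ := Function.update G 0 (limUnder (𝓝[≠] 0) G) with hG₀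
  have heq {z : ℂ} (hz : z ≠ 0) : G₀ z = G z := Function.update_of_ne hz _ _
  have hint := integral_boundary_rect_eq_zero_of_differentiableOn G₀
    (⟨-1 / 2, -(τ.im / 2)⟩ : ℂ) (⟨1 / 2, τ.im / 2⟩ : ℂ) (hdiff.mono fun z hz => by
      obtain ⟨hz1, hz2⟩ := hz
      simp only [mem_preimage] at hz1 hz2
      rw [uIcc_of_le (by norm_num)] at hz1
      rw [uIcc_of_le (by linarith)] at hz2
      have hz3 : |z.re| < 1 := abs_lt.2 ⟨by linarith [hz1.1], by linarith [hz1.2]⟩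
      have hz4 : |z.im| < τ.im := abs_lt.2 ⟨by linarith [hz2.1], by linarith [hz2.2]⟩
      exact ⟨hz3, hz4⟩)
  have hside (y : ℝ) : G₀ ((1 / 2 : ℝ) + y * I) = G₀ ((-1 / 2 : ℝ) + y * I) := by
    rw [heq fun h => by simpa using congrArg re h, heq fun h => by simpa using congrArg re h,
      ← h1 ((-1 / 2 : ℝ) + y * I)]
    congr 1
    push_cast
    ring
  have hrow {y : ℝ} (hy : y ≠ 0) (x : ℝ) : G₀ (x + y * I) = G (x + y * I) :=
    heq fun h => hy (by simpa using congrArg im h)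
  simp only [hside, hrow (neg_ne_zero.2 (half_pos hτ).ne'), hrow (half_pos hτ).ne'] at hint
  rw [add_sub_cancel_right, sub_eq_zero] at hint
  exact hint

end strip

section expansion

variable {τ : ℂ}

lemma eq_sum_thetam_two_of_quasiperiodic (hτ : 0 < τ.im) {F : ℂ → ℂ}
    (hd : ∀ z ∈ latticeCompl τ, DifferentiableAt ℂ F z) (h1 : ∀ z, F (z + 1) = F z)
    (hq : ∀ z, F (z + τ) = (qq z ^ 4 * qq τ ^ 2)⁻¹ * F z)
    (h0 : Tendsto (fun z => (qq z - 1) * F z) (𝓝[latticeCompl τ] 0) (𝓝 0)) :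
    ∃ H : ZMod 4 → ℂ, ∀ z ∈ latticeCompl τ, F z = ∑ r : ZMod 4, H r * thetam 2 (r.val : ℤ) τ z := by
  set w : ℂ := (-(τ.im / 2) : ℝ) * I with hw
  have hline (x : ℝ) : (x : ℂ) + w ∈ latticeCompl τ :=
    mem_latticeCompl_of_im_eq hτ (by simp [hw])
  let G : ℤ → ℂ → ℂ := fun n z => F z * qq (-n * z)
  have hqd (n : ℤ) : Differentiable ℂ fun z => qq (-n * z) :=
    differentiable_qq.comp (differentiable_id.const_mul _)
  have hG1 (n : ℤ) (z : ℂ) : G n (z + 1) = G n z := by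
    have : qq (-n * (z + 1)) = qq (-n * z) := by
      rw [mul_add, qq_add, mul_one]
      have := qq_int (-n)
      push_cast at this
      rw [this, mul_one]
    simp only [G, h1, this]
  have hGτ (n : ℤ) (z : ℂ) : G n (z + τ) = qq (-(n + 2) * τ) * G (n + 4) z := by
    have h4 : qq z ^ 4 * qq τ ^ 2 = qq (4 * z + 2 * τ) := by
      rw [qq, qq, qq, ← exp_nat_mul, ← exp_nat_mul, ← exp_add]
      congr 1
      push_cast
      ring
    have h5 : (qq (4 * z + 2 * τ))⁻¹ * qq (-n * (z + τ))
        = qq (-(n + 2) * τ) * qq (-(n + 4 : ℤ) * z) := by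
      rw [qq, qq, qq, qq, ← exp_neg, ← exp_add, ← exp_add]
      congr 1
      push_cast
      ring
    simp only [G]
    rw [hq, h4]
    linear_combination F z * h5
  let C : ℤ → ℂ := fun n => ∫ x : ℝ in (-1 / 2)..(1 / 2), G n (x + w)
  have hC (n : ℤ) : C n = qq (-(n + 2) * τ) * C (n + 4) := by
    have hs : C n = ∫ x : ℝ in (-1 / 2)..(1 / 2), G n (x + (τ.im / 2 : ℝ) * I) := by
      refine integral_strip_eq hτ (fun z hz => (hd z hz).mul (hqd n z)) (hG1 n) ?_
      have hc : Tendsto (fun z => qq (-n * z)) (𝓝[latticeCompl τ] 0) (𝓝 (qq (-n * 0))) :=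
        ((hqd n).continuous.tendsto 0).mono_left nhdsWithin_le_nhds
      simpa [G, mul_assoc] using h0.mul hc
    let g : ℝ → ℂ := fun x => G (n + 4) (x + w)
    have hg : Function.Periodic g 1 := fun x => by
      simp only [g]
      rw [← hG1 (n + 4) (x + w)]
      congr 1
      push_cast
      ring
    have hrow (x : ℝ) : G n (x + (τ.im / 2 : ℝ) * I) = qq (-(n + 2) * τ) * g (x - τ.re) := by
      rw [← hGτ]
      congr 1
      rw [hw]
      push_cast
      linear_combination re_add_im τ
    rw [hs]
    simp only [hrow, intervalIntegral.integral_const_mul,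
      intervalIntegral.integral_comp_sub_right g]
    congr 1
    have := hg.intervalIntegral_add_eq (-1 / 2 - τ.re) (-1 / 2)
    rw [show -1 / 2 - τ.re + 1 = 1 / 2 - τ.re by ring,
      show (-1 / 2 + 1 : ℝ) = 1 / 2 by norm_num] at this
    exact this
  let h : ℤ → ℂ := fun n => C n * qq (-((n : ℂ) ^ 2 / 8 * τ))
  have hh : Function.Periodic h 4 := fun n => by
    have : qq (-((n : ℂ) ^ 2 / 8 * τ)) * qq (-(n + 2) * τ)
        = qq (-(((n + 4 : ℤ) : ℂ) ^ 2 / 8 * τ)) := by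
      rw [← qq_add]
      congr 1
      push_cast
      ring
    simp only [h]
    rw [hC n, ← this]
    ring
  let H : ZMod 4 → ℂ := fun r => h r.val
  have hH (n : ℤ) : H n = h n := by
    have h4 : (((n : ZMod 4).val : ℤ)) = n % 4 := ZMod.val_intCast n
    simp only [H]
    rw [h4, Int.emod_def, mul_comm]
    exact hh.sub_zsmul_eq (n / 4)
  have hCθ (n : ℤ) (z : ℂ) : C n * qq (n * z) = H n * thetaTerm τ n z := by
    rw [hH, thetaTerm, qq_add, mul_comm (qq (n * z))]
    have : qq (-((n : ℂ) ^ 2 / 8 * τ)) * qq ((n : ℂ) ^ 2 / 8 * τ) = 1 := by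
      rw [← qq_add, neg_add_cancel, qq, mul_zero, exp_zero]
    simp only [h]
    linear_combination -(C n * qq (n * z)) * this
  refine ⟨H, ?_⟩
  have hon (x : ℝ) : F (x + w) = ∑ r : ZMod 4, H r * thetam 2 (r.val : ℤ) τ (x + w) := by
    have hsw := (hasSum_mul_thetaTerm hτ H w).summable
    simp only [← hCθ] at hsw
    have hf : Continuous fun x : ℝ => F (x + w) := continuous_iff_continuousAt.2 fun x =>
      (hd _ (hline x)).continuousAt.comp (f := fun x : ℝ => (x : ℂ) + w) (by fun_prop)
    have hp : Function.Periodic (fun x : ℝ => F (x + w)) 1 := fun x => by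
      simp only
      rw [← h1 (x + w)]
      congr 1
      push_cast
      ring
    have hsum := hasSum_fourier_of_periodic hf hp (c := fun n => C n * qq (n * w)) (-1 / 2)
      (fun n => by
        simp only [C, G]
        rw [← intervalIntegral.integral_mul_const, show (-1 / 2 + 1 : ℝ) = 1 / 2 by norm_num]
        congr 1
        funext x
        rw [mul_assoc, ← qq_add]
        congr 2
        ring) hsw x
    have hsum2 := hasSum_mul_thetaTerm hτ H (x + w)
    refine hsum.unique ?_
    have e : (fun n : ℤ => C n * qq (n * w) * qq (n * x)) =
        fun n : ℤ => H n * thetaTerm τ n (x + w) := by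
      funext n
      rw [← hCθ, mul_add, qq_add]
      ring
    rw [e]
    exact hsum2
  have hopen := isOpen_latticeCompl hτ
  have hF : AnalyticOnNhd ℂ F (latticeCompl τ) :=
    DifferentiableOn.analyticOnNhd (fun z hz => (hd z hz).differentiableWithinAt) hopen
  have hΘ : AnalyticOnNhd ℂ (fun z => ∑ r : ZMod 4, H r * thetam 2 (r.val : ℤ) τ z)
      (latticeCompl τ) := by
    refine DifferentiableOn.analyticOnNhd (Differentiable.differentiableOn ?_) hopen
    exact Differentiable.fun_sum fun r _ => (differentiable_thetam_two hτ _).const_mul _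
  refine hF.eqOn_of_preconnected_of_frequently_eq hΘ isPreconnected_latticeCompl (hline 0) ?_
  have ht : Tendsto (fun x : ℝ => (x : ℂ) + w) (𝓝[≠] 0) (𝓝[≠] ((0 : ℝ) + w)) := by
    refine tendsto_nhdsWithin_iff.2 ⟨?_, ?_⟩
    · exact (Continuous.tendsto (f := fun x : ℝ => (x : ℂ) + w) (by fun_prop) 0).mono_left
        nhdsWithin_le_nhds
    · filter_upwards [self_mem_nhdsWithin] with x hx
      simpa using hx
  exact ht.frequently (Frequently.of_forall hon)

lemma eq_zero_of_sum_thetam_two_eq_zero (hτ : 0 < τ.im) {H : ZMod 4 → ℂ}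
    (h : ∀ z ∈ latticeCompl τ, ∑ r : ZMod 4, H r * thetam 2 (r.val : ℤ) τ z = 0) : H = 0 := by
  set w : ℂ := (-(τ.im / 2) : ℝ) * I with hw
  have key (n : ℤ) : H n * thetaTerm τ n w = 0 := by
    refine eq_zero_of_hasSum_qq (a := fun n : ℤ => H n * thetaTerm τ n w)
      (hasSum_mul_thetaTerm hτ H w).summable.norm (fun x => ?_) n
    have hx : (x : ℂ) + w ∈ latticeCompl τ := mem_latticeCompl_of_im_eq hτ (by simp [hw])
    rw [← h _ hx]
    have e : (fun n : ℤ => H n * thetaTerm τ n w * qq (n * x)) =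
        fun n : ℤ => H n * thetaTerm τ n (x + w) := by
      funext n
      rw [thetaTerm, thetaTerm, mul_assoc, ← qq_add]
      congr 2
      ring
    rw [e]
    exact hasSum_mul_thetaTerm hτ H (x + w)
  funext r
  have hr := (mul_eq_zero.1 (key r.val)).resolve_right (qq_ne_zero _)
  simpa using hr

end expansion

/-- There is a unique family of functions `H_r : ℍ → ℂ`, `r ∈ ℤ/4ℤ`, with
`−2 Ψ_{1,1}(τ,z) φ^{(2)}_1(τ,z) = −24 μ_{2,0}(τ,z) + ∑_{r mod 4} H_r(τ) θ_{2,r}(τ,z)`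
for all `τ ∈ ℍ` and `z ∉ ℤτ + ℤ`. -/
theorem stmt_11 :
    ∃! H : ZMod 4 → UpperHalfPlane → ℂ,
      ∀ (τ : UpperHalfPlane) (z : ℂ), (∀ a b : ℤ, z ≠ (a : ℂ) * (τ : ℂ) + (b : ℂ)) →
        -2 * Psi11 (τ : ℂ) z * phi21 (τ : ℂ) z
          = -24 * mu 2 (τ : ℂ) z +
            ∑ r : ZMod 4, H r τ * thetam 2 (r.val : ℤ) (τ : ℂ) z := by
  have hex (τ : UpperHalfPlane) : ∃ H : ZMod 4 → ℂ, ∀ z ∈ latticeCompl (τ : ℂ),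
      -2 * Psi11 (τ : ℂ) z * phi21 (τ : ℂ) z + 24 * mu 2 (τ : ℂ) z
        = ∑ r : ZMod 4, H r * thetam 2 (r.val : ℤ) (τ : ℂ) z := by
    have hτ : 0 < (τ : ℂ).im := τ.im_pos
    refine eq_sum_thetam_two_of_quasiperiodic hτ (fun z hz => ?_) (fun z => ?_) (fun z => ?_) ?_
    · exact (((differentiableAt_Psi11 hτ hz).const_mul _).mul (differentiable_phi21 hτ z)).add
        ((differentiableAt_mu_two hτ hz).const_mul _)
    · rw [Psi11_add_one hτ, phi21_add_one hτ, mu_add_one]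
    · rw [Psi11_add_tau hτ, phi21_add_tau hτ, mu_two_add_tau,
        show qq z ^ 4 * qq (τ : ℂ) ^ 2 = (qq z ^ 2 * qq (τ : ℂ)) ^ 2 by ring, ← inv_pow]
      ring
    · have hφ : Tendsto (phi21 (τ : ℂ)) (𝓝[latticeCompl (τ : ℂ)] 0) (𝓝 12) := by
        rw [← phi21_zero hτ]
        exact ((differentiable_phi21 hτ).continuous.tendsto 0).mono_left nhdsWithin_le_nhds
      have := (((tendsto_Psi11_zero hτ).mul hφ).const_mul (-2)).add
        ((tendsto_mu_two_zero hτ).const_mul 24)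
      rw [show (-2 * (2 * 12) + 24 * 2 : ℂ) = 0 by norm_num] at this
      exact this.congr fun z => by ring
  choose H hH using hex
  refine ⟨fun r τ => H τ r, fun τ z hz => ?_, fun H' hH' => ?_⟩
  · linear_combination hH τ z hz
  · have hsub (τ : UpperHalfPlane) : (fun r => H' r τ - H τ r) = 0 := by
      refine eq_zero_of_sum_thetam_two_eq_zero (τ := (τ : ℂ)) τ.im_pos fun z hz => ?_
      simp only [sub_mul, Finset.sum_sub_distrib]
      linear_combination hH τ z hz - hH' τ z hz
    funext r τ
    exact sub_eq_zero.1 (congrFun (hsub τ) r)
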